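/- The graph F(9,13,2), defined as the simple graph on vertex set {1,...,9} with edge set {{1,2},{2,3},{3,4},{1,4},{1,8},{5,8},{5,6},{6,7},{2,7},{3,6},{4,5},{2,9},{8,9}}, is forbidden: there is no injective map φ : {1,...,9} → ℝ² with dist(φ(i), φ(j)) = 1 for every edge {i,j}. -/

import Mathlib

lemma rhombus_aux {A B C D : EuclideanSpace ℝ (Fin 2)}
    (h1 : dist A B = 1) (h2 : dist B C = 1) (h3 : dist C D = 1) (h4 : dist A D = 1)
    (hAC : A ≠ C) (hBD : B ≠ D) : A + C = B + D := by
  have key : ∀ X Y : EuclideanSpace ℝ (Fin 2), dist X Y = 1 →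
      (X 0 - Y 0) ^ 2 + (X 1 - Y 1) ^ 2 = 1 := by
    intro X Y h
    have h' : dist X Y ^ 2 = 1 := by rw [h]; norm_num
    rw [EuclideanSpace.dist_sq_eq] at h'
    simpa [Fin.sum_univ_two, Real.dist_eq, sq_abs] using h'
  have pos : ∀ X Y : EuclideanSpace ℝ (Fin 2), X ≠ Y →
      (X 0 - Y 0) ^ 2 + (X 1 - Y 1) ^ 2 ≠ 0 := by
    intro X Y h h0
    apply h
    have e0 : X 0 - Y 0 = 0 := by nlinarith [sq_nonneg (X 0 - Y 0), sq_nonneg (X 1 - Y 1)]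
    have e1 : X 1 - Y 1 = 0 := by nlinarith [sq_nonneg (X 0 - Y 0), sq_nonneg (X 1 - Y 1)]
    ext i
    fin_cases i
    · exact sub_eq_zero.mp e0
    · exact sub_eq_zero.mp e1
  have k1 := key _ _ h1
  have k2 := key _ _ h2
  have k3 := key _ _ h3
  have k4 := key _ _ h4
  have q1 := pos _ _ hAC
  have q2 := pos _ _ hBD
  have us : (A 0 - C 0) * (A 0 + C 0 - B 0 - D 0) + (A 1 - C 1) * (A 1 + C 1 - B 1 - D 1) = 0 := by
    linarith
  have vs : (B 0 - D 0) * (A 0 + C 0 - B 0 - D 0) + (B 1 - D 1) * (A 1 + C 1 - B 1 - D 1) = 0 := by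
    linarith
  have uv : (A 0 - C 0) * (B 0 - D 0) + (A 1 - C 1) * (B 1 - D 1) = 0 := by
    linarith
  have q := mul_ne_zero q1 q2
  have hd : (A 0 - C 0) * (B 1 - D 1) - (A 1 - C 1) * (B 0 - D 0) ≠ 0 := by
    intro hd
    apply q
    generalize A 0 - C 0 = a at *
    generalize A 1 - C 1 = b at *
    generalize B 0 - D 0 = c at *
    generalize B 1 - D 1 = d at *
    linear_combination (a * d - b * c) * hd + (a * c + b * d) * uv
  have s0 : A 0 + C 0 - B 0 - D 0 = 0 := by
    refine (mul_eq_zero.mp ?_).resolve_left hd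
    linear_combination (B 1 - D 1) * us - (A 1 - C 1) * vs
  have s1 : A 1 + C 1 - B 1 - D 1 = 0 := by
    refine (mul_eq_zero.mp ?_).resolve_left hd
    linear_combination (A 0 - C 0) * vs - (B 0 - D 0) * us
  ext i
  fin_cases i
  · show A 0 + C 0 = B 0 + D 0
    linarith
  · show A 1 + C 1 = B 1 + D 1
    linarith

theorem F_9_13_2_forbidden :
    ¬ ∃ φ : ℕ → EuclideanSpace ℝ (Fin 2),
      Set.InjOn φ (Set.Icc 1 9) ∧
      dist (φ 1) (φ 2) = 1 ∧
      dist (φ 2) (φ 3) = 1 ∧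
      dist (φ 3) (φ 4) = 1 ∧
      dist (φ 1) (φ 4) = 1 ∧
      dist (φ 1) (φ 8) = 1 ∧
      dist (φ 5) (φ 8) = 1 ∧
      dist (φ 5) (φ 6) = 1 ∧
      dist (φ 6) (φ 7) = 1 ∧
      dist (φ 2) (φ 7) = 1 ∧
      dist (φ 3) (φ 6) = 1 ∧
      dist (φ 4) (φ 5) = 1 ∧
      dist (φ 2) (φ 9) = 1 ∧
      dist (φ 8) (φ 9) = 1 := by
  rintro ⟨φ, hinj, h12, h23, h34, h14, h18, h58, h56, h67, h27, h36, h45, h29, h89⟩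
  have ne : ∀ i j : ℕ, 1 ≤ i → i ≤ 9 → 1 ≤ j → j ≤ 9 → i ≠ j → φ i ≠ φ j :=
    fun i j a b c d hij h => hij (hinj ⟨a, b⟩ ⟨c, d⟩ h)
  have n : ∀ i j : ℕ, (1 ≤ i ∧ i ≤ 9 ∧ 1 ≤ j ∧ j ≤ 9 ∧ i ≠ j) → φ i ≠ φ j :=
    fun i j ⟨a, b, c, d, e⟩ => ne i j a b c d e
  have r1 := rhombus_aux h12 h23 h34 h14 (n 1 3 (by decide)) (n 2 4 (by decide))
  have r2 := rhombus_aux h34 h45 h56 h36 (n 3 5 (by decide)) (n 4 6 (by decide))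
  have r3 := rhombus_aux h14 h45 h58 h18 (n 1 5 (by decide)) (n 4 8 (by decide))
  have r4 := rhombus_aux h23 h36 h67 h27 (n 2 6 (by decide)) (n 3 7 (by decide))
  have r5 := rhombus_aux h12 h29 (by rw [dist_comm]; exact h89) h18
    (n 1 9 (by decide)) (n 2 8 (by decide))
  apply n 7 9 (by decide)
  linear_combination (norm := module) r3 - r2 - r4 - r5
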